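/- Let b be a nonconstant element of the closed unit ball H∞₁ of the bounded holomorphic functions on the open unit disk 𝔻. Suppose there exists a holomorphic function h on b(𝔻) such that h(b(z)) = z for all z ∈ 𝔻, and such that the function z ↦ (z − b(0))/h(z) extends to a holomorphic function on all of 𝔻 satisfying |(z − b(0))/h(z)| ≤ |1 − conj(b(0))·z| for all z ∈ 𝔻. Then H(b) has the complete Nevanlinna–Pick property. -/

import Mathlib

open Complex Set Filter MeasureTheory

noncomputable section

/-- The open unit disk in `ℂ`. -/
def unitDisk : Set ℂ := Metric.ball 0 1

/-- `K` is a positive kernel on the unit disk: it is Hermitian symmetric and all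
finite Gram-type sums are (real and) nonnegative. -/
def IsPosKernel (K : ℂ → ℂ → ℂ) : Prop :=
  (∀ z ∈ unitDisk, ∀ w ∈ unitDisk, K z w = starRingEnd ℂ (K w z)) ∧
  ∀ (n : ℕ) (lam : Fin n → ℂ), (∀ i, lam i ∈ unitDisk) →
    ∀ c : Fin n → ℂ,
      0 ≤ (∑ i, ∑ j, c i * starRingEnd ℂ (c j) * K (lam i) (lam j)).re

/-- `b` belongs to the closed unit ball `H∞₁` of bounded holomorphic functions on
the unit disk. -/
def MemBallHinf (b : ℂ → ℂ) : Prop :=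
  DifferentiableOn ℂ b unitDisk ∧ ∀ z ∈ unitDisk, ‖b z‖ ≤ 1

/-- `b` is nonconstant on the unit disk. -/
def NonconstOnDisk (b : ℂ → ℂ) : Prop :=
  ∃ z ∈ unitDisk, ∃ w ∈ unitDisk, b z ≠ b w

/-- The de Branges–Rovnyak kernel `k^b(z,w) = (1 - conj (b w) * b z) / (1 - conj w * z)`. -/
def dbrKernel (b : ℂ → ℂ) (z w : ℂ) : ℂ :=
  (1 - starRingEnd ℂ (b w) * b z) / (1 - starRingEnd ℂ w * z)

/-- The de Branges–Rovnyak space `H(b)` has the complete Nevanlinna–Pick property: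
`k^b` never vanishes on `𝔻 × 𝔻` and
`(z,w) ↦ 1 - k^b(z,0) k^b(0,w) / (k^b(0,0) k^b(z,w))` is a positive kernel. -/
def HasCNP (b : ℂ → ℂ) : Prop :=
  (∀ z ∈ unitDisk, ∀ w ∈ unitDisk, dbrKernel b z w ≠ 0) ∧
  IsPosKernel (fun z w =>
    1 - dbrKernel b z 0 * dbrKernel b 0 w / (dbrKernel b 0 0 * dbrKernel b z w))

/-- `f` belongs to the Hardy space `H²` with Taylor coefficient sequence `a`:
`f z = ∑ₙ a n * zⁿ` on the unit disk and `∑ₙ ‖a n‖² < ∞`. -/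
def MemH2 (f : ℂ → ℂ) (a : ℕ → ℂ) : Prop :=
  (∀ z ∈ unitDisk, HasSum (fun n => a n * z ^ n) (f z)) ∧
  Summable (fun n => ‖a n‖ ^ 2)

open ComplexConjugate in
/-- Positivity of the de Branges–Rovnyak kernel relative to the disk of radius `R < 1`: with
`G`, `F` combinations of the Szegő kernels of that disk, the sum is the mean over the circle of
`G * conj G - 2 * ψ * F * conj G + F * conj F`, whose real part is nonnegative. -/
lemma pick_sum_nonneg_of_radius {ψ : ℂ → ℂ} (hψ : DifferentiableOn ℂ ψ unitDisk)
    (hψ1 : ∀ z ∈ unitDisk, ‖ψ z‖ ≤ 1) {R : ℝ} (hR1 : R < 1) {n : ℕ} (lam : Fin n → ℂ)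
    (hlam : ∀ i, ‖lam i‖ < R) (hR0 : 0 < R) (c : Fin n → ℂ) :
    0 ≤ (∑ i, ∑ j, c i * conj (c j) *
      ((1 - ψ (lam i) * conj (ψ (lam j))) * (R ^ 2 / (R ^ 2 - lam i * conj (lam j))))).re := by
  set k : Fin n → ℂ → ℂ := fun j z => R ^ 2 / (R ^ 2 - z * conj (lam j)) with hk
  set G : ℂ → ℂ := fun z => ∑ j, conj (c j) * k j z with hG
  set F : ℂ → ℂ := fun z => ∑ j, conj (c j) * conj (ψ (lam j)) * k j z with hF
  have hden : ∀ j, ∀ z ∈ Metric.closedBall (0 : ℂ) R, (R : ℂ) ^ 2 - z * conj (lam j) ≠ 0 := by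
    intro j z hz h0
    have h1 : (R : ℂ) ^ 2 = z * conj (lam j) := sub_eq_zero.1 h0
    have h2 := congrArg norm h1
    rw [norm_mul, norm_pow, RCLike.norm_conj, norm_real, Real.norm_of_nonneg hR0.le] at h2
    have hz' : ‖z‖ ≤ R := by simpa using hz
    nlinarith [hlam j, norm_nonneg z, norm_nonneg (lam j)]
  have hkd : ∀ j, DifferentiableOn ℂ (k j) (Metric.closedBall 0 R) := fun j =>
    DifferentiableOn.div (by fun_prop) (by fun_prop) (hden j)
  have hGd : DifferentiableOn ℂ G (Metric.closedBall 0 R) := by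
    refine DifferentiableOn.fun_sum fun j _ => ?_
    exact (hkd j).const_mul _
  have hFd : DifferentiableOn ℂ F (Metric.closedBall 0 R) := by
    refine DifferentiableOn.fun_sum fun j _ => ?_
    exact (hkd j).const_mul _
  have hψd : DifferentiableOn ℂ ψ (Metric.closedBall 0 R) :=
    hψ.mono (Metric.closedBall_subset_ball hR1)
  set f : Fin n → ℂ → ℂ := fun i z => c i * (G z - 2 * ψ z * F z + ψ (lam i) * F z) with hf
  have hfd : ∀ i, DifferentiableOn ℂ (f i) (Metric.closedBall 0 R) := fun i => by
    have h1 := ((hψd.const_mul 2).mul hFd)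
    exact ((hGd.sub h1).add (hFd.const_mul _)).const_mul _
  have hball : ∀ i, lam i ∈ Metric.ball (0 : ℂ) R := fun i => by simpa using hlam i
  have hcauchy : ∀ i, (∮ z in C(0, R), (z - lam i)⁻¹ • f i z) = (2 * Real.pi * I) • f i (lam i) :=
    fun i => DifferentiableOn.circleIntegral_sub_inv_smul (hfd i) (hball i)
  have hint : ∀ i, CircleIntegrable (fun z => (z - lam i)⁻¹ • f i z) 0 R := fun i => by
    refine ContinuousOn.circleIntegrable hR0.le (ContinuousOn.fun_smul ?_
      ((hfd i).continuousOn.mono Metric.sphere_subset_closedBall))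
    refine ContinuousOn.inv₀ (by fun_prop) fun z hz h0 => ?_
    have : z = lam i := sub_eq_zero.1 h0
    have hz' : ‖z‖ = R := by simpa using hz
    exact (hlam i).ne (this ▸ hz')
  have hsum : (∮ z in C(0, R), ∑ i, (z - lam i)⁻¹ • f i z)
      = (2 * Real.pi * I) * ∑ i, f i (lam i) := by
    rw [circleIntegral.integral_fun_sum fun i _ => hint i, Finset.mul_sum]
    exact Finset.sum_congr rfl fun i _ => hcauchy i
  have hpt : ∀ z ∈ Metric.sphere (0 : ℂ) R,
      z * ∑ i, (z - lam i)⁻¹ • f i z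
        = G z * conj (G z) - 2 * (ψ z * F z * conj (G z)) + F z * conj (F z) := by
    intro z hz
    have hz' : ‖z‖ = R := by simpa using hz
    have hzz : z * conj z = (R : ℂ) ^ 2 := by rw [mul_conj, normSq_eq_norm_sq, hz']; simp
    have hz0 : z ≠ 0 := by rw [← norm_pos_iff, hz']; exact hR0
    have hkc : ∀ i, conj (k i z) = z * (z - lam i)⁻¹ := by
      intro i
      have h1 : z - lam i ≠ 0 := fun h0 => (hlam i).ne (sub_eq_zero.1 h0 ▸ hz')
      have h2 : conj z ≠ 0 := (map_ne_zero _).2 hz0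
      simp only [hk, map_div₀, map_sub, map_mul, map_pow, conj_conj, conj_ofReal]
      rw [← hzz, mul_comm z, ← mul_sub, mul_div_mul_left _ _ h2, div_eq_mul_inv]
    have hGc : conj (G z) = ∑ i, c i * (z * (z - lam i)⁻¹) := by
      simp only [hG, map_sum, map_mul, conj_conj, hkc]
    have hFc : conj (F z) = ∑ i, c i * ψ (lam i) * (z * (z - lam i)⁻¹) := by
      simp only [hF, map_sum, map_mul, conj_conj, hkc]
    rw [hGc, hFc]
    simp only [Finset.mul_sum, ← Finset.sum_sub_distrib, ← Finset.sum_add_distrib, hf, smul_eq_mul]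
    exact Finset.sum_congr rfl fun i _ => by ring
  have hre : ∀ z ∈ Metric.sphere (0 : ℂ) R, 0 ≤ (z * ∑ i, (z - lam i)⁻¹ • f i z).re := by
    intro z hz
    have hz' : ‖z‖ = R := by simpa using hz
    have h1 : ‖ψ z‖ ≤ 1 := hψ1 z (by simpa [unitDisk, hz'] using hR1)
    have h2 : (ψ z * F z * conj (G z)).re ≤ ‖F z‖ * ‖G z‖ := by
      refine (re_le_norm _).trans ?_
      rw [norm_mul, norm_mul, RCLike.norm_conj]
      have := mul_le_mul_of_nonneg_right h1 (norm_nonneg (F z))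
      exact mul_le_mul_of_nonneg_right (by linarith) (norm_nonneg _)
    rw [hpt z hz, mul_conj, mul_conj, normSq_eq_norm_sq, normSq_eq_norm_sq]
    have h3 : (2 * (ψ z * F z * conj (G z))).re = 2 * (ψ z * F z * conj (G z)).re := by simp
    rw [add_re, sub_re, h3, ofReal_re, ofReal_re]
    nlinarith [sq_nonneg (‖G z‖ - ‖F z‖)]
  have hS : ∑ i, f i (lam i) = ∑ i, ∑ j, c i * conj (c j) *
      ((1 - ψ (lam i) * conj (ψ (lam j))) * (R ^ 2 / (R ^ 2 - lam i * conj (lam j)))) := by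
    refine Finset.sum_congr rfl fun i _ => ?_
    simp only [hf, hG, hF, hk, Finset.mul_sum, ← Finset.sum_sub_distrib,
      ← Finset.sum_add_distrib]
    exact Finset.sum_congr rfl fun j _ => by ring
  rw [← hS]
  have hpar : (∮ z in C(0, R), ∑ i, (z - lam i)⁻¹ • f i z)
      = I * ∫ θ in (0 : ℝ)..2 * Real.pi,
        (circleMap 0 R θ * ∑ i, (circleMap 0 R θ - lam i)⁻¹ • f i (circleMap 0 R θ)) := by
    rw [circleIntegral, ← intervalIntegral.integral_const_mul]
    refine intervalIntegral.integral_congr fun θ _ => ?_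
    simp only [deriv_circleMap, smul_eq_mul]
    ring
  have hkey : (∫ θ in (0 : ℝ)..2 * Real.pi,
      (circleMap 0 R θ * ∑ i, (circleMap 0 R θ - lam i)⁻¹ • f i (circleMap 0 R θ)))
      = ((2 * Real.pi : ℝ) : ℂ) * ∑ i, f i (lam i) := by
    refine mul_left_cancel₀ I_ne_zero ?_
    rw [← hpar, hsum]
    push_cast
    ring
  have hii : IntervalIntegrable (fun θ : ℝ => circleMap 0 R θ *
      ∑ i, (circleMap 0 R θ - lam i)⁻¹ • f i (circleMap 0 R θ)) volume 0 (2 * Real.pi) := by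
    have h1 : CircleIntegrable (fun z => ∑ i, (z - lam i)⁻¹ • f i z) 0 R :=
      CircleIntegrable.fun_sum _ fun i _ => hint i
    exact IntervalIntegrable.continuousOn_mul h1 (by fun_prop)
  have hnn : 0 ≤ (∫ θ in (0 : ℝ)..2 * Real.pi,
      (circleMap 0 R θ * ∑ i, (circleMap 0 R θ - lam i)⁻¹ • f i (circleMap 0 R θ))).re := by
    have h1 := reCLM.intervalIntegral_comp_comm hii
    simp only [reCLM_apply] at h1
    rw [← h1]
    exact intervalIntegral.integral_nonneg (by positivity) fun θ _ =>
      hre _ (circleMap_mem_sphere 0 hR0.le θ)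
  rw [hkey, re_ofReal_mul] at hnn
  exact nonneg_of_mul_nonneg_right hnn (by positivity)

lemma one_sub_mul_conj_ne_zero {x y : ℂ} (hx : ‖x‖ < 1) (hy : ‖y‖ < 1) :
    1 - x * starRingEnd ℂ y ≠ 0 := by
  intro h0
  have h1 := congrArg norm (sub_eq_zero.1 h0)
  rw [norm_one, norm_mul, RCLike.norm_conj] at h1
  nlinarith [norm_nonneg x, norm_nonneg y]

/-- The de Branges–Rovnyak kernel of a function in the closed unit ball of `H∞` is positive. -/
lemma pick_sum_nonneg {ψ : ℂ → ℂ} (hψ : DifferentiableOn ℂ ψ unitDisk)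
    (hψ1 : ∀ z ∈ unitDisk, ‖ψ z‖ ≤ 1) {n : ℕ} (lam : Fin n → ℂ)
    (hlam : ∀ i, ‖lam i‖ < 1) (c : Fin n → ℂ) :
    0 ≤ (∑ i, ∑ j, c i * starRingEnd ℂ (c j) *
      ((1 - ψ (lam i) * starRingEnd ℂ (ψ (lam j))) /
        (1 - lam i * starRingEnd ℂ (lam j)))).re := by
  have hlim : Tendsto (fun R : ℝ => (∑ i, ∑ j, c i * starRingEnd ℂ (c j) *
      ((1 - ψ (lam i) * starRingEnd ℂ (ψ (lam j))) *
        ((R : ℂ) ^ 2 / ((R : ℂ) ^ 2 - lam i * starRingEnd ℂ (lam j))))).re)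
      (nhdsWithin 1 (Iio 1)) (nhds (∑ i, ∑ j, c i * starRingEnd ℂ (c j) *
      ((1 - ψ (lam i) * starRingEnd ℂ (ψ (lam j))) /
        (1 - lam i * starRingEnd ℂ (lam j)))).re) := by
    refine (continuous_re.tendsto _).comp ?_
    refine tendsto_finsetSum _ fun i _ => tendsto_finsetSum _ fun j _ => ?_
    refine Tendsto.const_mul _ ?_
    rw [div_eq_mul_inv, ← one_div]
    refine Tendsto.const_mul _ ?_
    have h1 : Tendsto (fun R : ℝ => (R : ℂ) ^ 2) (nhdsWithin 1 (Iio 1)) (nhds 1) := by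
      have : Continuous fun R : ℝ => (R : ℂ) ^ 2 := by fun_prop
      simpa using (this.tendsto 1).mono_left nhdsWithin_le_nhds
    exact h1.div (h1.sub_const _) (one_sub_mul_conj_ne_zero (hlam i) (hlam j))
  refine ge_of_tendsto hlim ?_
  have hev : ∀ i, ∀ᶠ R : ℝ in nhdsWithin 1 (Iio 1), ‖lam i‖ < R := fun i =>
    nhdsWithin_le_nhds (eventually_gt_nhds (hlam i))
  filter_upwards [self_mem_nhdsWithin, eventually_all.2 hev,
    nhdsWithin_le_nhds (eventually_gt_nhds (zero_lt_one' ℝ))] with R h1 h2 h3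
  exact pick_sum_nonneg_of_radius hψ hψ1 h1 lam h2 h3 c

lemma norm_lt_one_of_nonconst {b : ℂ → ℂ} (hb : MemBallHinf b) (hnc : NonconstOnDisk b)
    {z : ℂ} (hz : z ∈ unitDisk) : ‖b z‖ < 1 := by
  refine lt_of_le_of_ne (hb.2 z hz) fun h1 => ?_
  obtain ⟨x, hx, y, hy, hxy⟩ := hnc
  have hmax : IsMaxOn (norm ∘ b) unitDisk z := fun w hw => by
    simpa [h1] using hb.2 w hw
  have heq := eqOn_of_isPreconnected_of_isMaxOn_norm
    (convex_ball (0 : ℂ) 1).isPreconnected Metric.isOpen_ball hb.1 hz hmax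
  exact hxy ((heq hx).trans (heq hy).symm)

/-- if there is a holomorphic function `h` on `b(𝔻)` with
`h ∘ b = id` on `𝔻`, such that `z ↦ (z - b 0)/h z` extends holomorphically to `𝔻`
with `|(z - b 0)/h z| ≤ |1 - conj (b 0) * z|` on `𝔻`, then `H(b)` has the complete
Nevanlinna–Pick property. -/
theorem deBrangesRovnyak_CNP_sufficient (b : ℂ → ℂ) (hb : MemBallHinf b)
    (hnc : NonconstOnDisk b) (h : ℂ → ℂ)
    (hhol : DifferentiableOn ℂ h (b '' unitDisk))
    (hinv : ∀ z ∈ unitDisk, h (b z) = z) (g : ℂ → ℂ)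
    (ghol : DifferentiableOn ℂ g unitDisk)
    (hagree : ∀ z ∈ b '' unitDisk, h z ≠ 0 → g z = (z - b 0) / h z)
    (hbound : ∀ z ∈ unitDisk, ‖g z‖ ≤ ‖1 - starRingEnd ℂ (b 0) * z‖) :
    HasCNP b := by
  have hlt : ∀ z ∈ unitDisk, ‖b z‖ < 1 := fun z hz => norm_lt_one_of_nonconst hb hnc hz
  have h0 : (0 : ℂ) ∈ unitDisk := by simp [unitDisk]
  have hdisk : ∀ z ∈ unitDisk, ‖z‖ < 1 := fun z hz => by simpa [unitDisk] using hz
  have hg : ∀ z ∈ unitDisk, z * g (b z) = b z - b 0 := by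
    intro z hz
    rcases eq_or_ne z 0 with rfl | hz0
    · simp
    · rw [hagree _ (mem_image_of_mem b hz) (by rwa [hinv z hz]), hinv z hz,
        mul_div_cancel₀ _ hz0]
  have hne : ∀ {x y : ℂ}, ‖x‖ < 1 → ‖y‖ < 1 → 1 - starRingEnd ℂ y * x ≠ 0 := fun hx hy => by
    rw [mul_comm]; exact one_sub_mul_conj_ne_zero hx hy
  set β := b 0 with hβ
  have hβ1 : ‖β‖ < 1 := hlt 0 h0
  set ψ : ℂ → ℂ := fun x => g x / (1 - starRingEnd ℂ β * x) with hψ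
  have hψd : DifferentiableOn ℂ ψ unitDisk :=
    ghol.div (by fun_prop) fun x hx => hne (hdisk x hx) hβ1
  have hψ1 : ∀ x ∈ unitDisk, ‖ψ x‖ ≤ 1 := fun x hx => by
    rw [hψ, norm_div]
    exact div_le_one_of_le₀ (hbound x hx) (norm_nonneg _)
  have hker : ∀ z ∈ unitDisk, ∀ w ∈ unitDisk,
      1 - dbrKernel b z 0 * dbrKernel b 0 w / (dbrKernel b 0 0 * dbrKernel b z w)
        = ((1 - ‖β‖ ^ 2 : ℝ) : ℂ)⁻¹ * ((z * (1 - starRingEnd ℂ β * b z)) *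
          starRingEnd ℂ (w * (1 - starRingEnd ℂ β * b w)) *
          ((1 - ψ (b z) * starRingEnd ℂ (ψ (b w))) / (1 - b z * starRingEnd ℂ (b w)))) := by
    intro z hz w hw
    have hs : ((1 - ‖β‖ ^ 2 : ℝ) : ℂ) = 1 - starRingEnd ℂ β * β := by
      rw [mul_comm, mul_conj, normSq_eq_norm_sq]; push_cast; ring
    have e1 := hne (hlt z hz) hβ1
    have e2 := hne hβ1 (hlt w hw)
    have e3 := hne (hlt z hz) (hlt w hw)
    have e4 := hne hβ1 hβ1
    have e5 := hne (hdisk z hz) (hdisk w hw)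
    have hgz := hg z hz
    have hgw := congrArg (starRingEnd ℂ) (hg w hw)
    rw [hs, mul_comm (b z) (starRingEnd ℂ (b w))]
    simp only [dbrKernel, hψ, ← hβ, map_mul, map_sub, map_div₀, map_one, conj_conj, map_zero,
      mul_zero, zero_mul, sub_zero, div_one] at hgw ⊢
    rw [mul_comm (starRingEnd ℂ (b w)) β] at e2
    generalize starRingEnd ℂ (b w) = y at *
    generalize starRingEnd ℂ (g (b w)) = gy at *
    generalize starRingEnd ℂ w = v at *
    generalize starRingEnd ℂ β = α at *
    generalize b z = x at *
    generalize g x = gx at *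
    have e2' : 1 - y * β ≠ 0 := by rwa [mul_comm]
    have e3' : 1 - x * y ≠ 0 := by rwa [mul_comm]
    have hprod : (z * gx) * (v * gy) = (x - β) * (y - α) := by rw [hgz, hgw]
    field_simp
    linear_combination hprod
  refine ⟨fun z hz w hw => div_ne_zero (hne (hlt z hz) (hlt w hw)) (hne (hdisk z hz) (hdisk w hw)),
    fun z hz w hw => ?_, fun n lam hlam c => ?_⟩
  · simp only [dbrKernel, map_mul, map_sub, map_div₀, map_one, conj_conj, map_zero]
    ring
  · have hpos : 0 ≤ (1 - ‖β‖ ^ 2)⁻¹ :=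
      inv_nonneg.2 (by nlinarith [norm_nonneg β])
    have hP := pick_sum_nonneg hψd hψ1 (fun i => b (lam i)) (fun i => hlt _ (hlam i))
      (fun i => c i * (lam i * (1 - starRingEnd ℂ β * b (lam i))))
    have hsum : (∑ i, ∑ j, c i * starRingEnd ℂ (c j) *
        (1 - dbrKernel b (lam i) 0 * dbrKernel b 0 (lam j) /
          (dbrKernel b 0 0 * dbrKernel b (lam i) (lam j))))
        = (((1 - ‖β‖ ^ 2)⁻¹ : ℝ) : ℂ) * ∑ i, ∑ j,
          (c i * (lam i * (1 - starRingEnd ℂ β * b (lam i)))) *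
          starRingEnd ℂ (c j * (lam j * (1 - starRingEnd ℂ β * b (lam j)))) *
          ((1 - ψ (b (lam i)) * starRingEnd ℂ (ψ (b (lam j)))) /
            (1 - b (lam i) * starRingEnd ℂ (b (lam j)))) := by
      simp only [Finset.mul_sum]
      refine Finset.sum_congr rfl fun i _ => Finset.sum_congr rfl fun j _ => ?_
      rw [hker _ (hlam i) _ (hlam j), map_mul (starRingEnd ℂ) (c j), ofReal_inv]
      ring
    rw [hsum, re_ofReal_mul]
    exact mul_nonneg hpos hP
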